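/- Let q = 1. Suppose P(|G| > μ) = 1 for some constant μ > 0 and E[G²] < ∞, and assume δ > M_1(ε). Then for every constant μ̃ with 0 < μ̃ < μ, as σ_w → 0: AMSE(σ_w) − [δ·M_1(ε)/(δ − M_1(ε))]·σ_w² = o( φ( √((δ − M_1(ε))/δ) · μ̃/σ_w ) ). -/

import Mathlib

open MeasureTheory ProbabilityTheory Real Filter Set Asymptotics

noncomputable section

/-- The standard Gaussian measure on `ℝ`. -/
def stdGaussian : Measure ℝ := gaussianReal 0 1

/-- Soft thresholding, i.e. `η₁(u;χ) = sign(u)·max(|u|−χ,0)`. -/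
def soft (u χ : ℝ) : ℝ := Real.sign u * max (|u| - χ) 0

/-- `M₁(ε) = inf_{χ ≥ 0} [(1−ε)·E[η₁(Z;χ)²] + ε(1+χ²)]`, `Z ~ N(0,1)`. -/
def M1 (ε : ℝ) : ℝ :=
  ⨅ χ : NNReal, ((1 - ε) * ∫ z, (soft z (χ:ℝ))^2 ∂stdGaussian + ε * (1 + (χ:ℝ)^2))

/-- The law of `B`: the mixture `(1−ε)δ₀ + ε·g`. -/
def mix (ε : ℝ) (g : Measure ℝ) : Measure ℝ :=
  ENNReal.ofReal (1 - ε) • Measure.dirac (0:ℝ) + ENNReal.ofReal ε • g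

/-- `min_{χ ≥ 0} E[(η(B+σZ;χ) − B)²]` where `B ~ μB`, `Z ~ N(0,1)` independent. -/
def riskMin (η : ℝ → ℝ → ℝ) (μB : Measure ℝ) (σ : ℝ) : ℝ :=
  ⨅ χ : NNReal, ∫ b, (∫ z, (η (b + σ * z) (χ:ℝ) - b)^2 ∂stdGaussian) ∂μB

/-- The standard normal density. -/
def phi (x : ℝ) : ℝ := (Real.sqrt (2 * Real.pi))⁻¹ * Real.exp (-x^2/2)

lemma soft_eq_sub_clamp (u : ℝ) {t : ℝ} (ht : 0 ≤ t) :
    soft u t = u - max (-t) (min t u) := by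
  unfold soft
  rcases lt_trichotomy u 0 with h | h | h
  · rw [Real.sign_of_neg h, abs_of_neg h, min_eq_right (by linarith)]
    rcases le_total (-u) t with h' | h'
    · rw [max_eq_right (by linarith), max_eq_right (by linarith)]; ring
    · rw [max_eq_left (by linarith), max_eq_left (by linarith)]; ring
  · subst h
    simp [ht]
  · rw [Real.sign_of_pos h, abs_of_pos h]
    rcases le_total u t with h' | h'
    · rw [max_eq_right (by linarith), min_eq_right h', max_eq_right (by linarith)]; ring
    · rw [max_eq_left (by linarith), min_eq_left h', max_eq_right (by linarith)]; ring

lemma soft_scaled_error (b z t σ : ℝ) (ht : 0 ≤ t) (hσ : 0 < σ) :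
    soft (b + σ * z) (σ * t) - b = σ * (z - max (-t) (min t (b / σ + z))) := by
  rw [soft_eq_sub_clamp _ (by positivity), mul_sub, mul_max_of_nonneg _ _ hσ.le,
    mul_min_of_nonneg _ _ hσ.le]
  have : σ * (b / σ + z) = b + σ * z := by field_simp
  rw [this, mul_neg]
  ring

/-- The mean square error of soft thresholding at level `t` for the mean `b` and unit noise. -/
def unitRisk (b t : ℝ) : ℝ := ∫ z, (z - max (-t) (min t (b + z))) ^ 2 ∂stdGaussian

instance : IsProbabilityMeasure stdGaussian := by
  unfold _root_.stdGaussian; infer_instance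

lemma integrable_id_stdGaussian : Integrable (fun z : ℝ => z) stdGaussian :=
  (memLp_id_gaussianReal (μ := 0) (v := 1) 1).integrable le_rfl

lemma integrable_sq_stdGaussian : Integrable (fun z : ℝ => z ^ 2) stdGaussian :=
  (memLp_id_gaussianReal (μ := 0) (v := 1) 2).integrable_sq

lemma integral_id_stdGaussian : ∫ z, z ∂stdGaussian = 0 :=
  integral_id_gaussianReal

lemma integral_sq_stdGaussian : ∫ z, z ^ 2 ∂stdGaussian = 1 := by
  have h := variance_id_gaussianReal (μ := 0) (v := 1)
  rw [variance_eq_sub (memLp_id_gaussianReal 2)] at h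
  simpa [_root_.stdGaussian] using h

lemma integral_quadratic_stdGaussian (p q r : ℝ) :
    Integrable (fun z : ℝ => p * z ^ 2 + q * z + r) stdGaussian ∧
      ∫ z, (p * z ^ 2 + q * z + r) ∂stdGaussian = p + r := by
  have h2 := integrable_sq_stdGaussian.const_mul p
  have h1 := integrable_id_stdGaussian.const_mul q
  have h21 : Integrable (fun z : ℝ => p * z ^ 2 + q * z) stdGaussian := h2.add h1
  refine ⟨h21.add (integrable_const r), ?_⟩
  rw [integral_add h21 (integrable_const r), integral_add h2 h1, integral_const_mul,
    integral_const_mul, integral_id_stdGaussian, integral_sq_stdGaussian]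
  simp

lemma integrable_sq_mul_exp_stdGaussian {k : ℝ} (hk : k < 1) (p r : ℝ) :
    Integrable (fun z : ℝ => (p * z ^ 2 + r) * Real.exp (k / 2 * z ^ 2)) stdGaussian := by
  unfold _root_.stdGaussian
  rw [gaussianReal_of_var_ne_zero _ one_ne_zero,
    integrable_withDensity_iff (measurable_gaussianPDF _ _)
      (ae_of_all _ fun _ => gaussianPDF_lt_top)]
  have hb : 0 < (1 - k) / 2 := by linarith
  have h2 := integrable_rpow_mul_exp_neg_mul_sq hb (s := 2) (by norm_num)
  have h0 := integrable_exp_neg_mul_sq hb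
  refine (((h2.const_mul p).add (h0.const_mul r)).const_mul (√(2 * π))⁻¹).congr
    (ae_of_all _ fun z => ?_)
  have : Real.exp (-((1 - k) / 2) * z ^ 2) = Real.exp (k / 2 * z ^ 2) * Real.exp (-z ^ 2 / 2) := by
    rw [← Real.exp_add]; ring_nf
  simp only [Pi.add_apply, toReal_gaussianPDF, gaussianPDFReal, Real.rpow_two, this]
  simp
  ring

lemma sq_sub_clamp_le (b z : ℝ) {t : ℝ} (ht : 0 ≤ t) :
    (z - max (-t) (min t (b + z))) ^ 2
      ≤ 1 * z ^ 2 + (-2 * max (-t) (min t b)) * z + t ^ 2 := by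
  have h1 : (max (-t) (min t (b + z))) ^ 2 ≤ t ^ 2 :=
    sq_le_sq' (le_max_left _ _) (max_le (by linarith) (min_le_left _ _))
  have h2 : 0 ≤ z * (max (-t) (min t (b + z)) - max (-t) (min t b)) := by
    rcases le_total 0 z with hz | hz
    · exact mul_nonneg hz (sub_nonneg.2
        (max_le_max le_rfl (min_le_min le_rfl (by linarith))))
    · exact mul_nonneg_of_nonpos_of_nonpos hz (sub_nonpos.2
        (max_le_max le_rfl (min_le_min le_rfl (by linarith))))
  nlinarith

lemma integrable_sq_sub_clamp (b : ℝ) {t : ℝ} (ht : 0 ≤ t) :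
    Integrable (fun z : ℝ => (z - max (-t) (min t (b + z))) ^ 2) stdGaussian := by
  refine (integral_quadratic_stdGaussian 1 (-2 * max (-t) (min t b)) (t ^ 2)).1.mono'
    (by fun_prop) (ae_of_all _ fun z => ?_)
  rw [Real.norm_of_nonneg (sq_nonneg _)]
  exact sq_sub_clamp_le b z ht

lemma unitRisk_nonneg (b t : ℝ) : 0 ≤ unitRisk b t :=
  integral_nonneg fun _ => sq_nonneg _

lemma unitRisk_le (b : ℝ) {t : ℝ} (ht : 0 ≤ t) : unitRisk b t ≤ 1 + t ^ 2 := by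
  obtain ⟨hi, he⟩ := integral_quadratic_stdGaussian 1 (-2 * max (-t) (min t b)) (t ^ 2)
  rw [← he]
  exact integral_mono (integrable_sq_sub_clamp b ht) hi fun z => sq_sub_clamp_le b z ht

lemma measurable_unitRisk (t : ℝ) : Measurable fun b => unitRisk b t := by
  have : StronglyMeasurable
      (Function.uncurry fun b z : ℝ => (z - max (-t) (min t (b + z))) ^ 2) := by
    apply Measurable.stronglyMeasurable
    unfold Function.uncurry
    fun_prop
  exact (this.integral_prod_right (ν := stdGaussian)).measurable

/-- For large mean and threshold, the unit risk is large. -/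
lemma le_unitRisk_of_large {b t w : ℝ} (hw : 0 ≤ w) (hb : w ≤ |b|) (ht : w + 2 ≤ t) :
    3 / 4 * w ^ 2 ≤ unitRisk b t := by
  obtain ⟨hi, he⟩ := integral_quadratic_stdGaussian (-(w ^ 2 / 4)) 0 (w ^ 2)
  have : 3 / 4 * w ^ 2 = -(w ^ 2 / 4) + w ^ 2 := by ring
  rw [this, ← he]
  refine integral_mono hi (integrable_sq_sub_clamp b (by linarith)) fun z => ?_
  simp only
  by_cases hz : |z| ≤ 2
  · obtain ⟨hz1, hz2⟩ := abs_le.1 hz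
    have : w ^ 2 ≤ (z - max (-t) (min t (b + z))) ^ 2 := by
      rw [sq_le_sq, abs_of_nonneg hw, le_abs]
      rcases le_abs.1 hb with h | h
      · right
        have : w + z ≤ max (-t) (min t (b + z)) :=
          le_max_of_le_right (le_min (by linarith) (by linarith))
        linarith
      · left
        have : max (-t) (min t (b + z)) ≤ z - w :=
          max_le (by linarith) ((min_le_right _ _).trans (by linarith))
        linarith
    nlinarith [mul_nonneg (sq_nonneg w) (sq_nonneg z)]
  · have : 4 ≤ z ^ 2 := by
      rw [← sq_abs]; nlinarith [not_le.1 hz]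
    nlinarith [mul_nonneg (sq_nonneg w) (sub_nonneg.2 this),
      sq_nonneg (z - max (-t) (min t (b + z)))]

/-- The constant controlling the exponentially small defect of the unit risk. -/
def tailConst (k T : ℝ) : ℝ :=
  ∫ z, (2 * z ^ 2 + 2 * T ^ 2) * Real.exp (k / 2 * z ^ 2) ∂stdGaussian

lemma tailConst_nonneg (k T : ℝ) : 0 ≤ tailConst k T :=
  integral_nonneg fun _ => by positivity

lemma exists_sq_le_sq_sub_clamp {b t T a k : ℝ} (ht : 0 ≤ t) (htT : t ≤ T) (ha : 0 ≤ a)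
    (hb : a + T ≤ |b|) (hk : 0 ≤ k) :
    ∃ v : ℝ, ∀ z : ℝ,
      (1 * z ^ 2 + (-2 * v) * z + t ^ 2)
        - Real.exp (-(k / 2 * a ^ 2)) * ((2 * z ^ 2 + 2 * T ^ 2) * Real.exp (k / 2 * z ^ 2))
      ≤ (z - max (-t) (min t (b + z))) ^ 2 := by
  have main : ∀ v : ℝ, v ^ 2 = t ^ 2 →
      (∀ z, |z| < a → max (-t) (min t (b + z)) = v) → ∀ z : ℝ,
      (1 * z ^ 2 + (-2 * v) * z + t ^ 2)
        - Real.exp (-(k / 2 * a ^ 2)) * ((2 * z ^ 2 + 2 * T ^ 2) * Real.exp (k / 2 * z ^ 2))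
      ≤ (z - max (-t) (min t (b + z))) ^ 2 := by
    intro v hv hc z
    by_cases hz : |z| < a
    · rw [hc z hz]
      have : 0 ≤ Real.exp (-(k / 2 * a ^ 2)) *
        ((2 * z ^ 2 + 2 * T ^ 2) * Real.exp (k / 2 * z ^ 2)) := by positivity
      nlinarith
    · have h1 : a ^ 2 ≤ z ^ 2 := by
        rw [← sq_abs z]; exact pow_le_pow_left₀ ha (not_lt.1 hz) 2
      have h2 : 1 ≤ Real.exp (-(k / 2 * a ^ 2)) * Real.exp (k / 2 * z ^ 2) := by
        rw [← Real.exp_add]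
        exact Real.one_le_exp (by nlinarith)
      have h3 : t ^ 2 ≤ T ^ 2 := pow_le_pow_left₀ ht htT 2
      have h4 : 0 ≤ 2 * z ^ 2 + 2 * T ^ 2 := by positivity
      nlinarith [mul_le_mul_of_nonneg_left h2 h4, sq_nonneg (z + v),
        sq_nonneg (z - max (-t) (min t (b + z)))]
  rcases le_abs.1 hb with h | h
  · refine ⟨t, main t rfl fun z hz => ?_⟩
    have := (abs_lt.1 hz).1
    rw [min_eq_left (by linarith), max_eq_right (by linarith)]
  · refine ⟨-t, main (-t) (by ring) fun z hz => ?_⟩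
    have := (abs_lt.1 hz).2
    rw [min_eq_right (by linarith), max_eq_left (by linarith)]

lemma le_unitRisk_of_bounded {b t T a k : ℝ} (ht : 0 ≤ t) (htT : t ≤ T) (ha : 0 ≤ a)
    (hb : a + T ≤ |b|) (hk : 0 ≤ k) (hk1 : k < 1) :
    1 + t ^ 2 - Real.exp (-(k / 2 * a ^ 2)) * tailConst k T ≤ unitRisk b t := by
  obtain ⟨v, h⟩ := exists_sq_le_sq_sub_clamp ht htT ha hb hk
  obtain ⟨hi, he⟩ := integral_quadratic_stdGaussian 1 (-2 * v) (t ^ 2)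
  have hi' := (integrable_sq_mul_exp_stdGaussian hk1 2 (2 * T ^ 2)).const_mul
    (Real.exp (-(k / 2 * a ^ 2)))
  rw [← he, tailConst, ← integral_const_mul, ← integral_sub hi hi']
  exact integral_mono (hi.sub hi') (integrable_sq_sub_clamp b ht) h

lemma M1_eq (ε : ℝ) :
    M1 ε = ⨅ t : NNReal, ((1 - ε) * unitRisk 0 t + ε * (1 + (t : ℝ) ^ 2)) := by
  unfold M1 unitRisk
  refine iInf_congr fun t => ?_
  simp_rw [zero_add, soft_eq_sub_clamp _ t.coe_nonneg]

lemma M1_le {ε : ℝ} (hε : ε ∈ Ioo (0 : ℝ) 1) (t : NNReal) :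
    M1 ε ≤ (1 - ε) * unitRisk 0 t + ε * (1 + (t : ℝ) ^ 2) := by
  rw [M1_eq]
  refine ciInf_le ⟨0, ?_⟩ t
  rintro _ ⟨s, rfl⟩
  have := unitRisk_nonneg 0 s
  have h1 : 0 ≤ 1 - ε := by linarith [hε.2]
  have h2 := hε.1
  positivity

lemma integrable_unitRisk (g : Measure ℝ) [IsFiniteMeasure g] (σ : ℝ) {t : ℝ} (ht : 0 ≤ t) :
    Integrable (fun b => unitRisk (b / σ) t) g := by
  refine (integrable_const (1 + t ^ 2)).mono'
    ((measurable_unitRisk t).comp (measurable_id.div_const σ)).aestronglyMeasurable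
    (ae_of_all _ fun b => ?_)
  rw [Real.norm_of_nonneg (unitRisk_nonneg _ _)]
  exact unitRisk_le _ ht

lemma integral_mix_risk {ε : ℝ} (hε : ε ∈ Ioo (0 : ℝ) 1) (g : Measure ℝ) [IsProbabilityMeasure g]
    {σ t : ℝ} (hσ : 0 < σ) (ht : 0 ≤ t) :
    ∫ b, (∫ z, (soft (b + σ * z) (σ * t) - b) ^ 2 ∂stdGaussian) ∂(mix ε g)
      = σ ^ 2 * ((1 - ε) * unitRisk 0 t + ε * ∫ b, unitRisk (b / σ) t ∂g) := by
  have h : ∀ b, ∫ z, (soft (b + σ * z) (σ * t) - b) ^ 2 ∂stdGaussian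
      = σ ^ 2 * unitRisk (b / σ) t := fun b => by
    simp_rw [soft_scaled_error b _ t σ ht hσ, mul_pow, integral_const_mul]
    rfl
  have h1 : 0 ≤ 1 - ε := by linarith [hε.2]
  simp_rw [h, integral_const_mul]
  rw [mix, integral_add_measure ((integrable_unitRisk _ σ ht).smul_measure ENNReal.ofReal_ne_top)
    ((integrable_unitRisk _ σ ht).smul_measure ENNReal.ofReal_ne_top), integral_smul_measure,
    integral_smul_measure, integral_dirac, ENNReal.toReal_ofReal h1,
    ENNReal.toReal_ofReal hε.1.le]
  simp

lemma riskMin_le {ε : ℝ} (hε : ε ∈ Ioo (0 : ℝ) 1) (g : Measure ℝ) [IsProbabilityMeasure g]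
    {σ : ℝ} (hσ : 0 < σ) : riskMin soft (mix ε g) σ ≤ σ ^ 2 * M1 ε := by
  rw [M1_eq, ← div_le_iff₀' (by positivity)]
  refine le_ciInf fun t => ?_
  rw [div_le_iff₀' (by positivity)]
  have hb : BddBelow (range fun χ : NNReal =>
      ∫ b, (∫ z, (soft (b + σ * z) (χ : ℝ) - b) ^ 2 ∂stdGaussian) ∂(mix ε g)) := by
    refine ⟨0, ?_⟩
    rintro _ ⟨s, rfl⟩
    exact integral_nonneg fun _ => integral_nonneg fun _ => sq_nonneg _
  refine (ciInf_le hb (σ.toNNReal * t)).trans ?_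
  rw [NNReal.coe_mul, Real.coe_toNNReal σ hσ.le, integral_mix_risk hε g hσ t.coe_nonneg]
  have : ∫ b, unitRisk (b / σ) t ∂g ≤ 1 + (t : ℝ) ^ 2 := by
    simpa using integral_mono (integrable_unitRisk g σ t.coe_nonneg)
      (integrable_const (1 + (t : ℝ) ^ 2)) fun b => unitRisk_le _ t.coe_nonneg
  have := hε.1
  gcongr

lemma le_riskMin {ε μ μt : ℝ} (hε : ε ∈ Ioo (0 : ℝ) 1) (hμt : 0 < μt) (hμtμ : μt < μ)
    (g : Measure ℝ) [IsProbabilityMeasure g] (hGμ : g {x : ℝ | μ < |x|} = 1) :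
    ∃ C, 0 ≤ C ∧ ∃ σ₀ > 0, ∀ σ, 0 < σ → σ < σ₀ →
      σ ^ 2 * M1 ε - riskMin soft (mix ε g) σ ≤ C * σ ^ 2 * Real.exp (-(μt / σ) ^ 2 / 2) := by
  obtain ⟨hε0, hε1⟩ := hε
  have hμ : 0 < μ := hμt.trans hμtμ
  have hae : ∀ᵐ b ∂g, μ < |b| := by
    have hm : MeasurableSet {x : ℝ | μ < |x|} := measurableSet_lt measurable_const (by fun_prop)
    exact (prob_compl_eq_zero_iff hm).2 hGμ
  have hlow : ∀ {σ t m : ℝ}, 0 < σ → 0 ≤ t → (∀ b, μ / σ < |b| → m ≤ unitRisk b t) →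
      m ≤ ∫ b, unitRisk (b / σ) t ∂g := by
    intro σ t m hσ ht h
    have := integral_mono_ae (integrable_const m) (integrable_unitRisk g σ ht)
      (hae.mono fun b hb => h (b / σ) (by rw [abs_div, abs_of_pos hσ]; gcongr))
    simpa using this
  set w : ℝ := 1 + |M1 ε| * (4 / (3 * ε)) with hw
  have hw1 : 1 ≤ w := by
    rw [hw]; have : 0 ≤ |M1 ε| * (4 / (3 * ε)) := by positivity
    linarith
  have hwM : M1 ε ≤ ε * (3 / 4 * w ^ 2) := by
    have h1 : w ≤ w ^ 2 := by nlinarith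
    have h2 : ε * (3 / 4 * w) = ε * (3 / 4) + |M1 ε| := by rw [hw]; field_simp
    nlinarith [le_abs_self (M1 ε), mul_le_mul_of_nonneg_left h1 hε0.le]
  set T : ℝ := w + 2 with hT
  obtain ⟨c, hc0, hc1⟩ := exists_between ((div_lt_one hμ).2 hμtμ)
  have hcpos : 0 < c := (div_pos hμt hμ).trans hc0
  have hcμ : μt < c * μ := (div_lt_iff₀ hμ).1 hc0
  have hk1 : c ^ 2 < 1 := by nlinarith
  have hK := tailConst_nonneg (c ^ 2) T
  refine ⟨ε * tailConst (c ^ 2) T, by positivity, min (μ / T) ((c * μ - μt) / (c * T)),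
    lt_min (by positivity) (div_pos (by linarith) (by positivity)), fun σ hσ hσ0 => ?_⟩
  have hσ1 : T < μ / σ := by
    rw [lt_div_iff₀' hσ]
    exact (lt_div_iff₀ (by positivity)).1 (hσ0.trans_le (min_le_left _ _))
  have hσ2 : σ * (c * T) < c * μ - μt :=
    (lt_div_iff₀ (by positivity)).1 (hσ0.trans_le (min_le_right _ _))
  have hexp : Real.exp (-(c ^ 2 / 2 * (μ / σ - T) ^ 2)) ≤ Real.exp (-(μt / σ) ^ 2 / 2) := by
    apply Real.exp_le_exp.2
    have h1 : μt / σ ≤ c * (μ / σ - T) := by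
      have : c * (μ / σ - T) = (c * μ - σ * (c * T)) / σ := by field_simp
      rw [this]; gcongr; linarith
    have h2 : (μt / σ) ^ 2 ≤ (c * (μ / σ - T)) ^ 2 := pow_le_pow_left₀ (by positivity) h1 2
    nlinarith
  set E := Real.exp (-(μt / σ) ^ 2 / 2)
  have hE0 : 0 < E := Real.exp_pos _
  suffices h : σ ^ 2 * (M1 ε - ε * tailConst (c ^ 2) T * E) ≤ riskMin soft (mix ε g) σ by
    linarith
  refine le_ciInf fun χ => ?_
  obtain ⟨t, rfl⟩ : ∃ t : NNReal, χ = σ.toNNReal * t :=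
    ⟨χ / σ.toNNReal, (mul_div_cancel₀ χ (Real.toNNReal_pos.2 hσ).ne').symm⟩
  rw [NNReal.coe_mul, Real.coe_toNNReal σ hσ.le, integral_mix_risk ⟨hε0, hε1⟩ g hσ t.coe_nonneg]
  refine mul_le_mul_of_nonneg_left ?_ (sq_nonneg σ)
  rcases le_total (t : ℝ) T with ht | ht
  · have h1 : 1 + (t : ℝ) ^ 2 - E * tailConst (c ^ 2) T ≤ ∫ b, unitRisk (b / σ) t ∂g := by
      refine hlow hσ t.coe_nonneg fun b hb => ?_
      have h2 := le_unitRisk_of_bounded (b := b) (a := μ / σ - T) t.coe_nonneg ht (by linarith)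
        (by linarith) (sq_nonneg c) hk1
      have h3 := mul_le_mul_of_nonneg_right hexp hK
      exact le_trans (by linarith) h2
    have h2 := M1_le ⟨hε0, hε1⟩ t
    have h3 := mul_le_mul_of_nonneg_left h1 hε0.le
    linarith
  · have h1 : 3 / 4 * w ^ 2 ≤ ∫ b, unitRisk (b / σ) t ∂g :=
      hlow hσ t.coe_nonneg fun b hb => le_unitRisk_of_large (by linarith) (by linarith) ht
    have h2 := mul_le_mul_of_nonneg_left h1 hε0.le
    have h3 : 0 ≤ (1 - ε) * unitRisk 0 t := mul_nonneg (by linarith) (unitRisk_nonneg _ _)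
    have h4 : 0 ≤ ε * tailConst (c ^ 2) T * E := by positivity
    linarith

/-- For `q = 1` (LASSO), if `P(|G| > μ) = 1`, `E[G²] < ∞` and `δ > M₁(ε)`, then for every
`0 < μ̃ < μ`, `AMSE(σ_w) − δM₁(ε)/(δ−M₁(ε))·σ_w² = o(φ(√((δ−M₁(ε))/δ)·μ̃/σ_w))` as `σ_w → 0⁺`.
Here `σb σ_w` is the unique positive solution `σ̄` of
`σ̄² = σ_w² + (1/δ)·min_{χ≥0}E[(η₁(B+σ̄Z;χ)−B)²]` and `AMSE(σ_w) = riskMin soft (mix ε g) (σb σ_w)`. -/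
theorem lasso_amse_expansion
    (δ ε μ μt : ℝ) (hδ0 : 0 < δ) (hδ : M1 ε < δ) (hε : ε ∈ Ioo (0:ℝ) 1)
    (hμ : 0 < μ) (hμt : 0 < μt) (hμtμ : μt < μ)
    (g : Measure ℝ) [IsProbabilityMeasure g] (hg0 : g {0} = 0)
    (hG2 : Integrable (fun x => x^2) g)
    (hGμ : g {x : ℝ | μ < |x|} = 1)
    (σb : ℝ → ℝ)
    (hσb : ∀ s, 0 < s → 0 < σb s ∧
      (σb s) ^ 2 = s ^ 2 + (1/δ) * riskMin soft (mix ε g) (σb s)) :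
    (fun s => riskMin soft (mix ε g) (σb s) - (δ * M1 ε / (δ - M1 ε)) * s ^ 2)
      =o[nhdsWithin (0:ℝ) (Ioi 0)]
      (fun s => phi (Real.sqrt ((δ - M1 ε) / δ) * μt / s)) := by
  have hd : 0 < δ - M1 ε := by linarith
  obtain ⟨C, hC, σ₀, hσ₀, hlow⟩ := le_riskMin hε hμt hμtμ g hGμ
  set a : ℝ := √((δ - M1 ε) / δ) with ha
  have ha0 : 0 < a := Real.sqrt_pos.2 (by positivity)
  have ha2 : a ^ 2 = (δ - M1 ε) / δ := Real.sq_sqrt (by positivity)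
  have hbound : ∀ s, 0 < s → σb s ≤ s / a := by
    intro s hs
    obtain ⟨hp, he⟩ := hσb s hs
    have h1 := riskMin_le hε g hp
    refine (sq_le_sq₀ hp.le (by positivity)).1 ?_
    rw [div_pow, le_div_iff₀ (by positivity), ha2, mul_div_assoc', div_le_iff₀ hδ0]
    have h2 : δ * σb s ^ 2 = δ * s ^ 2 + riskMin soft (mix ε g) (σb s) := by
      rw [he]; field_simp
    linarith
  have hsmall : ∀ᶠ s in nhdsWithin (0 : ℝ) (Ioi 0), s < a * σ₀ :=
    nhdsWithin_le_nhds (eventually_lt_nhds (by positivity))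
  have hO : (fun s => riskMin soft (mix ε g) (σb s) - (δ * M1 ε / (δ - M1 ε)) * s ^ 2)
      =O[nhdsWithin (0 : ℝ) (Ioi 0)] (fun s => s ^ 2 * phi (a * μt / s)) := by
    refine IsBigO.of_bound (δ / (δ - M1 ε) * C / a ^ 2 * √(2 * π)) ?_
    filter_upwards [self_mem_nhdsWithin, hsmall] with s hs hs0
    have hs : 0 < s := hs
    obtain ⟨hp, he⟩ := hσb s hs
    have hle := hbound s hs
    have h1 := riskMin_le hε g hp
    have h2 := hlow (σb s) hp (hle.trans_lt (by rwa [div_lt_iff₀' ha0]))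
    set R := riskMin soft (mix ε g) (σb s)
    have hR : R - δ * M1 ε / (δ - M1 ε) * s ^ 2
        = -(δ / (δ - M1 ε) * (σb s ^ 2 * M1 ε - R)) := by
      have h3 : s ^ 2 = σb s ^ 2 - R / δ := by rw [he]; ring
      rw [h3]; field_simp; ring
    have hphi : phi (a * μt / s) = (√(2 * π))⁻¹ * Real.exp (-(a * μt / s) ^ 2 / 2) := rfl
    have hexp : Real.exp (-(μt / σb s) ^ 2 / 2) ≤ Real.exp (-(a * μt / s) ^ 2 / 2) := by
      apply Real.exp_le_exp.2
      have h3 : a * μt / s ≤ μt / σb s := by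
        rw [div_le_div_iff₀ hs hp]
        have := (le_div_iff₀ ha0).1 hle
        nlinarith
      have h4 := pow_le_pow_left₀ (by positivity) h3 2
      linarith
    have hsq : σb s ^ 2 ≤ (s / a) ^ 2 := pow_le_pow_left₀ hp.le hle 2
    rw [hR, norm_neg, Real.norm_of_nonneg
      (mul_nonneg (by positivity) (by linarith)), hphi, Real.norm_of_nonneg (by positivity)]
    calc δ / (δ - M1 ε) * (σb s ^ 2 * M1 ε - R)
        ≤ δ / (δ - M1 ε) * (C * (s / a) ^ 2 * Real.exp (-(a * μt / s) ^ 2 / 2)) := by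
          refine mul_le_mul_of_nonneg_left (h2.trans ?_) (by positivity)
          gcongr
      _ = _ := by field_simp
  have ho : (fun s : ℝ => s ^ 2 * phi (a * μt / s))
      =o[nhdsWithin (0 : ℝ) (Ioi 0)] (fun s => phi (a * μt / s)) := by
    have ht : Tendsto (fun s : ℝ => s ^ 2) (nhdsWithin (0 : ℝ) (Ioi 0)) (nhds 0) := by
      have : Tendsto (fun s : ℝ => s ^ 2) (nhds 0) (nhds (0 ^ 2)) := (continuous_pow 2).tendsto 0
      rw [zero_pow two_ne_zero] at this
      exact this.mono_left nhdsWithin_le_nhds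
    simpa using ((isLittleO_one_iff ℝ).2 ht).mul_isBigO
      (isBigO_refl (fun s : ℝ => phi (a * μt / s)) _)
  exact hO.trans_isLittleO ho
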